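/- The critical points ξ_μ, μ ∈ P̂_c, are pairwise distinct (ξ_μ ≠ ξ_λ for μ ≠ λ) and all belong to the open alcove A = {ξ ∈ V : 0 < ⟨ξ,α⟩ < 2π for all α ∈ R₀⁺}; moreover, for each μ ∈ P̂_c the point ξ_μ depends real-analytically on the parameters t_α ∈ (−1,1). -/

import Mathlib

noncomputable section

open scoped RealInnerProductSpace BigOperators Classical
open Filter

namespace AffinePieri

variable {V : Type*} [NormedAddCommGroup V] [InnerProductSpace ℝ V] [FiniteDimensional ℝ V]

/-- The coroot `α^∨ = 2α/⟨α,α⟩` of a vector `α`. -/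
def coroot (α : V) : V := (2 / ⟪α, α⟫) • α

lemma refl_involutive (α : V) (k : ℝ) :
    Function.Involutive (fun x : V => x - (⟪x, coroot α⟫ + k) • α) := by
  intro x
  by_cases h : α = 0
  · simp [h, coroot]
  · have hαα : ⟪α, α⟫ ≠ 0 := fun hc => h (inner_self_eq_zero.mp hc)
    have h2 : ⟪α, coroot α⟫ = 2 := by
      rw [coroot, real_inner_smul_right]
      field_simp
    show (x - (⟪x, coroot α⟫ + k) • α) -
        (⟪x - (⟪x, coroot α⟫ + k) • α, coroot α⟫ + k) • α = x
    rw [inner_sub_left, real_inner_smul_left, h2]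
    have key : (⟪x, coroot α⟫ + k) +
        (⟪x, coroot α⟫ - (⟪x, coroot α⟫ + k) * 2 + k) = 0 := by ring
    rw [sub_sub, ← add_smul, key, zero_smul, sub_zero]

/-- The (affine) orthogonal reflection `x ↦ x - (⟨x,α^∨⟩ + k)α` as a permutation of `V`. -/
def reflP (α : V) (k : ℝ) : Equiv.Perm V :=
  Function.Involutive.toPerm _ (refl_involutive α k)

@[simp] lemma reflP_apply (α : V) (k : ℝ) (x : V) :
    reflP α k x = x - (⟪x, coroot α⟫ + k) • α := rfl

/-- The sign of a real number, as an integer. -/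
def zsgn (v : ℝ) : ℤ := if 0 < v then 1 else if v < 0 then -1 else 0

/-- Alternating composition `f ∘ g ∘ f ∘ ⋯` with `m` factors, used for braid relations. -/
def altOp {A : Type*} (f g : A → A) : ℕ → A → A
  | 0 => id
  | (k + 1) => f ∘ altOp g f k

/-- The interaction potential `v_α` entering the Morse (fusion) potential, for a
parameter family `s`. -/
def vintOf (s : V → ℝ) (α : V) (x : ℝ) : ℝ :=
  (1 - s α ^ 2) * ∫ y in (0:ℝ)..x, 1 / (1 - 2 * s α * Real.cos y + s α ^ 2)

/-- All the standing data of the paper: an irreducible reduced crystallographic root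
system `R₀` spanning the Euclidean space `V`, with a positive system, simple roots,
highest (short) roots, an admissible pair `(R₀, R̂₀)` encoded by the map `hat` and the
affine root `α₀`, a `W₀`-invariant multiplicity function `t` with values in `(-1,1)`,
and an integral level `c > 1`. -/
structure Setup (V : Type*) [NormedAddCommGroup V] [InnerProductSpace ℝ V]
    [FiniteDimensional ℝ V] where
  n : ℕ
  npos : 0 < n
  hdim : Module.finrank ℝ V = n
  R0 : Finset V
  zero_not_mem : (0 : V) ∉ R0
  span_top : Submodule.span ℝ (R0 : Set V) = ⊤
  cryst : ∀ α ∈ R0, ∀ β ∈ R0, ∃ k : ℤ, ⟪β, coroot α⟫ = (k : ℝ)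
  refl_mem : ∀ α ∈ R0, ∀ β ∈ R0, β - ⟪β, coroot α⟫ • α ∈ R0
  reduced : ∀ α ∈ R0, ∀ r : ℝ, r • α ∈ R0 → r = 1 ∨ r = -1
  irred : ¬ ∃ A B : Set V, A.Nonempty ∧ B.Nonempty ∧ A ∪ B = (R0 : Set V) ∧
      ∀ α ∈ A, ∀ β ∈ B, ⟪α, β⟫ = 0
  Rpos : Finset V
  pos_subset : Rpos ⊆ R0
  pos_partition : ∀ α ∈ R0, (α ∈ Rpos ↔ -α ∉ Rpos)
  simple : Fin n → V
  simple_mem : ∀ j, simple j ∈ Rpos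
  pos_decomp : ∀ α ∈ Rpos, ∃ f : Fin n → ℕ, α = ∑ j, (f j : ℝ) • simple j
  hroot : V
  hroot_mem : hroot ∈ Rpos
  hroot_highest : ∀ β ∈ R0, ∃ f : Fin n → ℕ, hroot - β = ∑ j, (f j : ℝ) • simple j
  hs : V
  hs_mem : hs ∈ Rpos
  hs_short : ∀ α ∈ R0, ⟪hs, hs⟫ ≤ ⟪α, α⟫
  hs_highest : ∀ β ∈ R0, ⟪β, β⟫ = ⟪hs, hs⟫ →
      ∃ f : Fin n → ℕ, hs - β = ∑ j, (f j : ℝ) • simple j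
  hat : V → V
  a0 : V
  admissible : ((∀ α : V, hat α = coroot α) ∧ a0 = -hs) ∨
      ((∀ α : V, hat α = (2 / ⟪hroot, hroot⟫) • α) ∧ a0 = -hroot)
  t : V → ℝ
  t_bound : ∀ α ∈ R0, |t α| < 1
  t_invariant : ∀ α ∈ R0, ∀ β ∈ R0, t (β - ⟪β, coroot α⟫ • α) = t β
  c : ℤ
  c_gt : 1 < c

namespace Setup

variable (S : Setup V)

/-- `m_α = 2/⟨α, α̂⟩`. -/
def m (α : V) : ℝ := 2 / ⟪α, S.hat α⟫

/-- The finite Weyl group `W₀`, generated by the reflections in the roots. -/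
def W0 : Subgroup (Equiv.Perm V) :=
  Subgroup.closure {w | ∃ α ∈ S.R0, w = reflP α 0}

/-- The affine Weyl group `W`, generated by the affine reflections
`s_a` for `a = α^∨ + m_α r c`. -/
def W : Subgroup (Equiv.Perm V) :=
  Subgroup.closure {w | ∃ α ∈ S.R0, ∃ r : ℤ, w = reflP α (S.m α * (r : ℝ) * (S.c : ℝ))}

/-- The `W₀`-orbit of a vector. -/
def orb (ω : V) : Set V := {x | ∃ w ∈ S.W0, w ω = x}

/-- The weight lattice `P` of `R₀`. -/
def Plat : Set V := {x | ∀ α ∈ S.R0, ∃ k : ℤ, ⟪x, coroot α⟫ = (k : ℝ)}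

/-- The root lattice `Q` of `R₀`. -/
def Qlat : Set V := (AddSubgroup.closure (S.R0 : Set V) : Set V)

/-- The semigroup `Q⁺` generated by the positive roots. -/
def Qplus : Set V := (AddSubmonoid.closure (S.Rpos : Set V) : Set V)

/-- The cone `P⁺` of dominant weights. -/
def Pplus : Set V := {x | x ∈ S.Plat ∧ ∀ α ∈ S.Rpos, 0 ≤ ⟪x, coroot α⟫}

/-- The dominant affine alcove `A_c = {x | 0 ≤ ⟨x,β⟩ ≤ c ∀ β ∈ R̂₀⁺}`. -/
def Alc : Set V := {x | ∀ α ∈ S.Rpos, 0 ≤ ⟪x, S.hat α⟫ ∧ ⟪x, S.hat α⟫ ≤ (S.c : ℝ)}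

/-- `P_c = P ∩ A_c`. -/
def Pc : Set V := {x | x ∈ S.Plat ∧ x ∈ S.Alc}

/-- The weight lattice `P̂` of `R̂₀`. -/
def Phat : Set V := {x | ∀ α ∈ S.R0, ∃ k : ℤ, ⟪x, coroot (S.hat α)⟫ = (k : ℝ)}

/-- `P̂_c = {μ ∈ P̂ | 0 ≤ ⟨μ,α⟩ ≤ c ∀ α ∈ R₀⁺}`. -/
def Phatc : Set V :=
  {x | x ∈ S.Phat ∧ ∀ α ∈ S.Rpos, 0 ≤ ⟪x, α⟫ ∧ ⟪x, α⟫ ≤ (S.c : ℝ)}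

/-- The half sum `ρ` of the positive roots of `R₀`. -/
def rho : V := (2⁻¹ : ℝ) • ∑ α ∈ S.Rpos, α

/-- The half sum `ρ̂` of the positive roots of `R̂₀`. -/
def rhoHat : V := (2⁻¹ : ℝ) • ∑ α ∈ S.Rpos, S.hat α

/-- The coroot lattice `Q̂^∨` of `R̂₀`. -/
def Qhatvee : Set V :=
  (AddSubgroup.closure ((fun α => coroot (S.hat α)) '' (S.R0 : Set V)) : Set V)

/-- The gradient (direction) of the affine simple root `a_j`:
`α₀` for `j = 0` and `α_j` otherwise. -/
def alpha (j : Fin (S.n + 1)) : V :=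
  if h : (j : ℕ) = 0 then S.a0 else S.simple ⟨(j : ℕ) - 1, by have := j.isLt; omega⟩

/-- The constant term of the affine simple root `a_j`. -/
def kconst (j : Fin (S.n + 1)) : ℝ := if (j : ℕ) = 0 then (S.c : ℝ) else 0

/-- The affine simple root `a_j` as an affine function on `V`. -/
def aFun (j : Fin (S.n + 1)) (x : V) : ℝ := ⟪x, coroot (S.alpha j)⟫ + S.kconst j

/-- The simple affine reflections `s_0, s_1, …, s_n`. -/
def sgen (j : Fin (S.n + 1)) : Equiv.Perm V := reflP (S.alpha j) (S.kconst j)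

/-- The length of an element of the affine Weyl group: the minimal length of an
expression as a product of the simple reflections. -/
def len (w : Equiv.Perm V) : ℕ :=
  sInf {k | ∃ l : List (Fin (S.n + 1)), l.length = k ∧ (l.map S.sgen).prod = w}

/-- The length of an element of the finite Weyl group w.r.t. the simple reflections. -/
def len0 (w : Equiv.Perm V) : ℕ :=
  sInf {k | ∃ l : List (Fin S.n), l.length = k ∧
    (l.map fun j => reflP (S.simple j) 0).prod = w}

/-- `l` is a reduced expression for `w`. -/
def IsReducedWord (l : List (Fin (S.n + 1))) (w : Equiv.Perm V) : Prop :=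
  (l.map S.sgen).prod = w ∧ l.length = S.len w

/-- The Bruhat partial order on the affine Weyl group. -/
def BruhatLE (v w : Equiv.Perm V) : Prop :=
  ∃ l : List (Fin (S.n + 1)), S.IsReducedWord l w ∧
    ∃ l' : List (Fin (S.n + 1)), l'.Sublist l ∧ (l'.map S.sgen).prod = v

/-- Evaluation of a function on the weight lattice at a point of `V` (by `0` off `P`). -/
def ev (f : ↥S.Plat → ℂ) (x : V) : ℂ := if h : x ∈ S.Plat then f ⟨x, h⟩ else 0

/-- The integral part `J_j` of the integral-reflection operators. -/
def Jop (j : Fin (S.n + 1)) (f : ↥S.Plat → ℂ) (x : ↥S.Plat) : ℂ :=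
  if 0 < Int.floor (S.aFun j x.1) then
    -∑ k ∈ Finset.Icc (1 : ℤ) (Int.floor (S.aFun j x.1)),
      S.ev f (x.1 - (k : ℝ) • S.alpha j)
  else if Int.floor (S.aFun j x.1) < 0 then
    ∑ k ∈ Finset.Icc (0 : ℤ) (-(Int.floor (S.aFun j x.1)) - 1),
      S.ev f (x.1 + (k : ℝ) • S.alpha j)
  else 0

/-- The integral-reflection operators `T_j = t_j s_j + (t_j - 1) J_j` on `𝒞(P)`. -/
def Top (j : Fin (S.n + 1)) (f : ↥S.Plat → ℂ) (x : ↥S.Plat) : ℂ :=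
  (S.t (S.alpha j) : ℂ) * S.ev f ((S.sgen j)⁻¹ x.1) +
    ((S.t (S.alpha j) : ℂ) - 1) * S.Jop j f x

/-- The operator `T_{j₁} ∘ ⋯ ∘ T_{j_ℓ}` attached to a word `l = [j₁, …, j_ℓ]`. -/
def wordOp (l : List (Fin (S.n + 1))) : (↥S.Plat → ℂ) → (↥S.Plat → ℂ) :=
  l.foldr (fun j g => S.Top j ∘ g) id

/-- `TW` realizes `w ↦ T_w` (via reduced expressions). -/
def IsTW (TW : Equiv.Perm V → (↥S.Plat → ℂ) → (↥S.Plat → ℂ)) : Prop :=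
  ∀ w l, S.IsReducedWord l w → TW w = S.wordOp l

/-- `tw` realizes the length multiplicative function `w ↦ t_w` (via reduced expressions). -/
def IsTmult (tw : Equiv.Perm V → ℂ) : Prop :=
  ∀ w l, S.IsReducedWord l w → tw w = (l.map fun j => (S.t (S.alpha j) : ℂ)).prod

/-- `wmin` realizes `x ↦ w_x`, the unique shortest affine Weyl group element moving `x`
into the dominant alcove. -/
def IsShortest (wmin : V → Equiv.Perm V) : Prop :=
  ∀ x : V, wmin x ∈ S.W ∧ wmin x x ∈ S.Alc ∧
    ∀ w ∈ S.W, w x ∈ S.Alc →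
      S.len (wmin x) ≤ S.len w ∧ (S.len w = S.len (wmin x) → w = wmin x)

/-- The positive affine roots, encoded as pairs `(α, r)` representing `α^∨ + m_α r c`. -/
def RplusP : Set (V × ℤ) :=
  {p | p.1 ∈ S.R0 ∧ (1 ≤ p.2 ∨ (p.2 = 0 ∧ p.1 ∈ S.Rpos))}

/-- The value of the affine root encoded by `p = (α, r)` at a point of `V`. -/
def affval (p : V × ℤ) (x : V) : ℝ :=
  ⟪x, coroot p.1⟫ + S.m p.1 * (p.2 : ℝ) * (S.c : ℝ)

/-- `R[λ] = {a ∈ R⁺ | a(λ) < 0}`. -/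
def Raff (lam : V) : Set (V × ℤ) := {p | p ∈ S.RplusP ∧ S.affval p lam < 0}

/-- `t[λ] = ∏_{a ∈ R[λ]} t_{a'}`. -/
def tBr (lam : V) : ℂ := ∏ᶠ p ∈ S.Raff lam, (S.t p.1 : ℂ)

/-- `θ(λ) = |{a ∈ R⁺ | a(λ) = -2}|`. -/
def thetaCt (lam : V) : ℕ :=
  Set.ncard {p : V × ℤ | p ∈ S.RplusP ∧ S.affval p lam = -2}

/-- The affine intertwining operator `𝒥`, defined via `wmin` and `TW`. -/
def JJ (wmin : V → Equiv.Perm V) (TW : Equiv.Perm V → (↥S.Plat → ℂ) → (↥S.Plat → ℂ))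
    (f : ↥S.Plat → ℂ) (x : ↥S.Plat) : ℂ :=
  (S.tBr x.1)⁻¹ * S.ev (TW (wmin x.1) f) (wmin x.1 x.1)

/-- The Morse (fusion-potential) function `𝒱_μ` for a parameter family `s`. -/
def MorseOf (s : V → ℝ) (μ ξ : V) : ℝ :=
  ((S.c : ℝ) / 2) * ⟪ξ, ξ⟫ - 2 * Real.pi * ⟪S.rhoHat + μ, ξ⟫ +
    ∑ α ∈ S.Rpos, (2 / ⟪α, coroot (S.hat α)⟫) * ∫ x in (0:ℝ)..(⟪ξ, α⟫), vintOf s α x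

/-- The Morse function `𝒱_μ` for the multiplicity function of the setup. -/
def Morse (μ ξ : V) : ℝ := S.MorseOf S.t μ ξ

/-- The critical equation `cξ + ∑_{α∈R₀⁺} v_α(⟨ξ,α⟩) α̂ = 2π(ρ̂ + μ)`. -/
def CritEq (μ x : V) : Prop :=
  (S.c : ℝ) • x + ∑ α ∈ S.Rpos, (vintOf S.t α ⟪x, α⟫) • S.hat α =
    (2 * Real.pi) • (S.rhoHat + μ)

/-- Extension of a parameter vector indexed by `R₀` to a function on `V` (by zero). -/
def extParam (s : ↥S.R0 → ℝ) : V → ℝ := fun α => if h : α ∈ S.R0 then s ⟨α, h⟩ else 0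

/-- `xi` realizes `μ ↦ ξ_μ`, the unique global minimizer of `𝒱_μ`. -/
def IsMinimizer (xi : V → V) : Prop :=
  ∀ μ ∈ S.Phat, ∀ x : V, x ≠ xi μ → S.Morse μ (xi μ) < S.Morse μ x

/-- The `c`-function of the Macdonald spherical function. -/
def Cfun (ξ : V) : ℂ :=
  ∏ α ∈ S.Rpos, (1 - (S.t α : ℂ) * Complex.exp (-(Complex.I * (⟪ξ, α⟫ : ℂ)))) /
      (1 - Complex.exp (-(Complex.I * (⟪ξ, α⟫ : ℂ))))

/-- The Macdonald spherical function `M_λ(ξ)`. -/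
def Msph (lam ξ : V) : ℂ :=
  ∑ᶠ w ∈ (S.W0 : Set (Equiv.Perm V)),
    S.Cfun (w ξ) * Complex.exp (Complex.I * (⟪w ξ, lam⟫ : ℂ))

/-- The orbit sum `m_ω(e^{iξ})`. -/
def mSym (ω ξ : V) : ℂ := ∑ᶠ ν ∈ S.orb ω, Complex.exp (Complex.I * (⟪ν, ξ⟫ : ℂ))

/-- The plane wave `e^{iξ} ∈ 𝒞(P)`. -/
def planewave (ξ : V) : ↥S.Plat → ℂ :=
  fun lam => Complex.exp (Complex.I * (⟪lam.1, ξ⟫ : ℂ))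

/-- The free operator `L_{ω;1}`. -/
def Lfree (ω : V) (f : ↥S.Plat → ℂ) (x : ↥S.Plat) : ℂ :=
  ∑ᶠ ν ∈ S.orb ω, S.ev f (x.1 + ν)

/-- `φ_ξ = ∑_{v ∈ W₀} T_v e^{iξ}`. -/
def phiW (TW : Equiv.Perm V → (↥S.Plat → ℂ) → (↥S.Plat → ℂ)) (ξ : V) : ↥S.Plat → ℂ :=
  ∑ᶠ w ∈ (S.W0 : Set (Equiv.Perm V)), TW w (S.planewave ξ)

/-- The affine Macdonald spherical function `Φ_ξ = 𝒥 φ_ξ`. -/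
def PhiA (wmin : V → Equiv.Perm V)
    (TW : Equiv.Perm V → (↥S.Plat → ℂ) → (↥S.Plat → ℂ)) (ξ : V) : ↥S.Plat → ℂ :=
  S.JJ wmin TW (S.phiW TW ξ)

/-- Invariance of a lattice function under the affine Weyl group. -/
def Winv (f : ↥S.Plat → ℂ) : Prop :=
  ∀ w ∈ S.W, ∀ x : ↥S.Plat, S.ev f (w⁻¹ x.1) = f x

/-- A minuscule dominant weight. -/
def Minuscule (ω : V) : Prop := ω ∈ S.Pplus ∧ ∀ α ∈ S.Rpos, ⟪ω, coroot α⟫ ≤ 1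

/-- `P_ϑ^⋆`: the orbit of the minuscule and quasi-minuscule weights. -/
def Pstar : Set V :=
  {x | ∃ w ∈ S.W0, ∃ η : V, (S.Minuscule η ∨ η = S.hs) ∧ x = w η}

/-- `ê_t(η) = ∏_{β∈R̂₀⁺} t_β^{⟨η,β^∨⟩/2}`. -/
def et (η : V) : ℂ :=
  ∏ α ∈ S.Rpos, (S.t α : ℂ) ^ (((⟪η, coroot (S.hat α)⟫ / 2 : ℝ) : ℂ))

/-- `ĥ_t = t_{α₀} ê_t(-α₀^∨)`. -/
def hhat : ℂ := (S.t S.a0 : ℂ) * S.et (-(coroot S.a0))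

/-- `e_t(ν) = ∏_{α∈R₀⁺} t_α^{⟨ν,α^∨⟩/2}`. -/
def elit (ν : V) : ℂ :=
  ∏ α ∈ S.Rpos, (S.t α : ℂ) ^ (((⟪ν, coroot α⟫ / 2 : ℝ) : ℂ))

/-- `h_t = t_ϑ e_t(-α₀)`. -/
def hlit : ℂ := (S.t S.hs : ℂ) * S.elit (-S.a0)

/-- The coefficients `d_{λ,ν}`. -/
def dcoef (lam ν : V) : ℂ :=
  if ν ∈ S.orb S.hs then
    (S.thetaCt (lam + ν) : ℂ) * S.elit (-ν) * S.hlit ^ zsgn ⟪lam, S.hat ν⟫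
  else 0

/-- The Pieri coefficients `V_{λ,ν}(t)`. -/
def Vcoef (lam ν : V) : ℂ :=
  (∏ α ∈ S.Rpos, if ⟪lam, S.hat α⟫ = 0 ∧ 0 < ⟪ν, S.hat α⟫ then
      (1 - (S.t α : ℂ) * S.et (S.hat α)) / (1 - S.et (S.hat α)) else 1) *
  ∏ α ∈ S.Rpos, if ⟪lam, S.hat α⟫ = (S.c : ℝ) ∧ ⟪ν, S.hat α⟫ < 0 then
      (1 - (S.t α : ℂ) * S.hhat * S.et (-(S.hat α))) / (1 - S.hhat * S.et (-(S.hat α)))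
    else 1

/-- The Pieri coefficients `U_{λ,ω}(t)`. -/
def Ucoef (wmin : V → Equiv.Perm V) (lam ω : V) : ℂ :=
  (∑ᶠ ν ∈ {ν | ν ∈ S.orb ω ∧ wmin (lam + ν) (lam + ν) = lam}, S.tBr (lam + ν)) +
    (1 - (S.t S.hs : ℂ)⁻¹) *
      ∑ᶠ ν ∈ {ν | ν ∈ S.orb ω ∧ wmin (lam + ν) lam = lam}, S.dcoef lam ν

/-- The linear part of an affine transformation of `V`. -/
def linp (w : Equiv.Perm V) (x : V) : V := w x - w (0 : V)

/-- The set `[x] = {y | y₊ = x₊, w_y ≤ w_x}`. -/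
def bra (wmin : V → Equiv.Perm V) (x : V) : Set V :=
  {y | wmin y y = wmin x x ∧ S.BruhatLE (wmin y) (wmin x)}

/-- The partial order `μ ⪯ λ`. -/
def preceq (wmin : V → Equiv.Perm V) (μ lam : V) : Prop :=
  lam - μ ∈ S.Qlat ∧ convexHull ℝ (S.bra wmin μ) ⊆ convexHull ℝ (S.bra wmin lam)

/-- The Weyl denominator `δ(ξ)`. -/
def weylDenom (ξ : V) : ℂ :=
  ∏ α ∈ S.Rpos, (Complex.exp (Complex.I * (⟪ξ, α⟫ : ℂ) / 2) -
      Complex.exp (-(Complex.I * (⟪ξ, α⟫ : ℂ) / 2)))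

/-- The Weyl character `χ_λ(ξ)`. -/
def chiW (lam ξ : V) : ℂ :=
  (S.weylDenom ξ)⁻¹ * ∑ᶠ w ∈ (S.W0 : Set (Equiv.Perm V)),
    ((-1 : ℂ) ^ S.len0 w) * Complex.exp (Complex.I * (⟪w ξ, lam + S.rho⟫ : ℂ))

/-- The counting function `N_{λ,ω}`. -/
def Ncount (lam ω : V) : ℕ :=
  Nat.card {j : Fin (S.n + 1) // S.aFun j lam = 0 ∧ S.alpha j ∈ S.orb ω}

end Setup


/-! ### Scalar interaction function -/

/-- Explicit form of the interaction function. -/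
def vE (t x : ℝ) : ℝ := x + 2 * Real.arctan (t * Real.sin x / (1 - t * Real.cos x))

lemma den_pos {t : ℝ} (ht : |t| < 1) (x : ℝ) : 0 < 1 - t * Real.cos x := by
  have h1 : |t * Real.cos x| < 1 := by
    rw [abs_mul]
    calc |t| * |Real.cos x| ≤ |t| * 1 :=
          mul_le_mul_of_nonneg_left (Real.abs_cos_le_one x) (abs_nonneg t)
      _ < 1 := by linarith
  have := (abs_lt.mp h1).2
  linarith

lemma den2_pos {t : ℝ} (ht : |t| < 1) (x : ℝ) : 0 < 1 - 2 * t * Real.cos x + t ^ 2 := by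
  have h1 := den_pos ht x
  have h2 := Real.sin_sq_add_cos_sq x
  have : 1 - 2 * t * Real.cos x + t ^ 2 = (1 - t * Real.cos x) ^ 2 + (t * Real.sin x) ^ 2 := by
    linear_combination (-t ^ 2) * h2
  rw [this]
  positivity

lemma one_sub_sq_pos {t : ℝ} (ht : |t| < 1) : 0 < 1 - t ^ 2 := by
  have := (sq_lt_one_iff_abs_lt_one t).mpr ht
  linarith

lemma hasDerivAt_vE {t : ℝ} (ht : |t| < 1) (x : ℝ) :
    HasDerivAt (vE t) ((1 - t ^ 2) * (1 / (1 - 2 * t * Real.cos x + t ^ 2))) x := by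
  have hd := den_pos ht x
  have hd2 := den2_pos ht x
  have h2 := Real.sin_sq_add_cos_sq x
  have hn : HasDerivAt (fun x => t * Real.sin x) (t * Real.cos x) x :=
    (Real.hasDerivAt_sin x).const_mul t
  have hdd : HasDerivAt (fun x => 1 - t * Real.cos x) (t * Real.sin x) x := by
    have := ((Real.hasDerivAt_cos x).const_mul t).const_sub 1
    refine this.congr_deriv ?_
    simp
  have hq := ((hn.div hdd hd.ne').arctan.const_mul 2)
  have := (hasDerivAt_id x).add hq
  refine this.congr_deriv ?_
  have e : 1 + (t * Real.sin x / (1 - t * Real.cos x)) ^ 2 =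
      (1 - 2 * t * Real.cos x + t ^ 2) / (1 - t * Real.cos x) ^ 2 := by
    field_simp
    linear_combination (t ^ 2) * h2
  simp only [Pi.div_apply]
  rw [e]
  field_simp
  linear_combination (-2 * t ^ 2) * h2

lemma continuous_vE {t : ℝ} (ht : |t| < 1) : Continuous (vE t) :=
  continuous_iff_continuousAt.mpr fun x => (hasDerivAt_vE ht x).continuousAt

lemma strictMono_vE {t : ℝ} (ht : |t| < 1) : StrictMono (vE t) := by
  apply strictMono_of_hasDerivAt_pos (fun x => hasDerivAt_vE ht x)
  intro x
  have := den2_pos ht x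
  have := one_sub_sq_pos ht
  positivity

lemma vE_neg (t x : ℝ) : vE t (-x) = -vE t x := by
  simp only [vE, Real.sin_neg, Real.cos_neg, mul_neg, neg_div, Real.arctan_neg]
  ring

lemma vE_zero (t : ℝ) : vE t 0 = 0 := by simp [vE]

lemma vE_add_int (t x : ℝ) (k : ℤ) : vE t (x + k * (2 * Real.pi)) = vE t x + k * (2 * Real.pi) := by
  simp only [vE, Real.sin_add_int_mul_two_pi, Real.cos_add_int_mul_two_pi]
  ring

lemma vintOf_eq (s : V → ℝ) (α : V) (hs : |s α| < 1) : vintOf s α = vE (s α) := by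
  funext x
  have hc : Continuous fun y => (1 - s α ^ 2) * (1 / (1 - 2 * s α * Real.cos y + s α ^ 2)) := by
    refine continuous_const.mul (continuous_const.div (by fun_prop) ?_)
    intro y
    exact (den2_pos hs y).ne'
  have := intervalIntegral.integral_eq_sub_of_hasDerivAt (a := 0) (b := x)
    (fun y _ => hasDerivAt_vE hs y) (hc.intervalIntegrable 0 x)
  rw [intervalIntegral.integral_const_mul, vE_zero, sub_zero] at this
  exact this

lemma int_vE_ge {t : ℝ} (ht : |t| < 1) (a b : ℝ) :
    vE t a * (b - a) ≤ (∫ x in (0:ℝ)..b, vE t x) - ∫ x in (0:ℝ)..a, vE t x := by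
  have hc := continuous_vE ht
  have hm := (strictMono_vE ht).monotone
  have hsub : (∫ x in (0:ℝ)..b, vE t x) - (∫ x in (0:ℝ)..a, vE t x) = ∫ x in a..b, vE t x :=
    intervalIntegral.integral_interval_sub_left (hc.intervalIntegrable 0 b)
      (hc.intervalIntegrable 0 a)
  rw [hsub]
  rcases le_total a b with h | h
  · have := intervalIntegral.integral_mono_on (μ := MeasureTheory.volume) h ((continuous_const (y := vE t a)).intervalIntegrable a b)
      (hc.intervalIntegrable a b) (fun x hx => hm hx.1)
    simp at this
    linarith
  · have := intervalIntegral.integral_mono_on (μ := MeasureTheory.volume) h (hc.intervalIntegrable b a)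
      ((continuous_const (y := vE t a)).intervalIntegrable b a) (fun x hx => hm hx.2)
    rw [intervalIntegral.integral_symm]
    simp at this
    linarith

lemma vE_step_ge {t : ℝ} (ht : |t| < 1) (k : ℤ) {x : ℝ} (hx : 2 * Real.pi ≤ x) (y : ℝ) :
    2 * Real.pi * (k : ℝ) ^ 2 ≤ k * (vE t y - vE t (y - k * x)) := by
  have hm := (strictMono_vE ht).monotone
  have h1 := vE_add_int t y (-k)
  push_cast at h1
  rcases le_total (0 : ℝ) k with h | h
  · have : vE t (y - k * x) ≤ vE t (y + -k * (2 * Real.pi)) := hm (by nlinarith)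
    nlinarith
  · have : vE t (y + -k * (2 * Real.pi)) ≤ vE t (y - k * x) := hm (by nlinarith)
    nlinarith

lemma vE_step_le {t : ℝ} (ht : |t| < 1) (k : ℝ) {x : ℝ} (hx : x ≤ 0) (y : ℝ) :
    k * (vE t y - vE t (y - k * x)) ≤ 0 := by
  have hm := (strictMono_vE ht).monotone
  rcases le_total (0 : ℝ) k with h | h
  · have : vE t y ≤ vE t (y - k * x) := hm (by nlinarith)
    nlinarith
  · have : vE t (y - k * x) ≤ vE t y := hm (by nlinarith)
    nlinarith

namespace Setup

variable (S : Setup V)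

/-! ### Root system preliminaries -/

lemma ne_zero_of_mem {α : V} (h : α ∈ S.R0) : α ≠ 0 := fun h0 => S.zero_not_mem (h0 ▸ h)

lemma inner_self_pos {α : V} (h : α ∈ S.R0) : 0 < ⟪α, α⟫ :=
  real_inner_self_pos.mpr (S.ne_zero_of_mem h)

lemma inner_coroot (x α : V) : ⟪x, coroot α⟫ = 2 / ⟪α, α⟫ * ⟪x, α⟫ := by
  rw [coroot, real_inner_smul_right]

lemma inner_self_coroot {α : V} (h : α ∈ S.R0) : ⟪α, coroot α⟫ = 2 := by
  have := S.inner_self_pos h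
  rw [inner_coroot]
  field_simp

/-- The proportionality factor between `α` and `hat α`. -/
def kk (α : V) : ℝ := 2 / ⟪α, coroot (S.hat α)⟫

lemma kk_of_smul {α : V} (h : α ∈ S.R0) {k : ℝ} (hk : 0 < k) (hh : S.hat α = k • α) :
    S.kk α = k := by
  have := S.inner_self_pos h
  rw [kk, hh, inner_coroot, real_inner_smul_left, real_inner_smul_right]
  field_simp

lemma kk_cases : (∀ α ∈ S.R0, S.hat α = (2 / ⟪α, α⟫) • α ∧ S.kk α = 2 / ⟪α, α⟫) ∨
    (∃ k : ℝ, 0 < k ∧ ∀ α ∈ S.R0, S.hat α = k • α ∧ S.kk α = k) := by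
  rcases S.admissible with h | h
  · left
    intro α hα
    have := S.inner_self_pos hα
    have h1 : S.hat α = (2 / ⟪α, α⟫) • α := h.1 α
    exact ⟨h1, S.kk_of_smul hα (by positivity) h1⟩
  · right
    have := S.inner_self_pos (S.pos_subset S.hroot_mem)
    refine ⟨2 / ⟪S.hroot, S.hroot⟫, by positivity, fun α hα => ⟨h.1 α, ?_⟩⟩
    exact S.kk_of_smul hα (by positivity) (h.1 α)

lemma kk_pos {α : V} (h : α ∈ S.R0) : 0 < S.kk α := by
  have := S.inner_self_pos h
  rcases S.kk_cases with h1 | ⟨k, hk, h1⟩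
  · rw [(h1 α h).2]; positivity
  · rw [(h1 α h).2]; exact hk

lemma hat_eq {α : V} (h : α ∈ S.R0) : S.hat α = S.kk α • α := by
  rcases S.kk_cases with h1 | ⟨k, hk, h1⟩
  · rw [(h1 α h).2]; exact (h1 α h).1
  · rw [(h1 α h).2]; exact (h1 α h).1

lemma kk_congr {α β : V} (hα : α ∈ S.R0) (hβ : β ∈ S.R0) (h : ⟪α, α⟫ = ⟪β, β⟫) :
    S.kk α = S.kk β := by
  rcases S.kk_cases with h1 | ⟨k, hk, h1⟩
  · rw [(h1 α hα).2, (h1 β hβ).2, h]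
  · rw [(h1 α hα).2, (h1 β hβ).2]

/-- Reflection. -/
def sr (β x : V) : V := x - ⟪x, coroot β⟫ • β

lemma sr_mem {α β : V} (hβ : β ∈ S.R0) (hα : α ∈ S.R0) : sr β α ∈ S.R0 :=
  S.refl_mem β hβ α hα

lemma inner_sr_left {β : V} (hβ : β ∈ S.R0) (x : V) : ⟪sr β x, β⟫ = -⟪x, β⟫ := by
  have := S.inner_self_pos hβ
  rw [sr, inner_sub_left, real_inner_smul_left, inner_coroot]
  field_simp
  ring

lemma inner_sr_coroot {β : V} (hβ : β ∈ S.R0) (x : V) :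
    ⟪sr β x, coroot β⟫ = -⟪x, coroot β⟫ := by
  rw [inner_coroot, inner_coroot, S.inner_sr_left hβ]
  ring

lemma sr_sr {β : V} (hβ : β ∈ S.R0) (x : V) : sr β (sr β x) = x := by
  have := S.inner_sr_coroot hβ x
  conv_lhs => rw [sr, this, sr]
  simp

lemma inner_sr_sr {β : V} (hβ : β ∈ S.R0) (x : V) : ⟪sr β x, sr β x⟫ = ⟪x, x⟫ := by
  have := S.inner_self_pos hβ
  rw [sr, inner_coroot, inner_sub_left, inner_sub_right, inner_sub_right, real_inner_smul_left,
    real_inner_smul_right, real_inner_smul_left, real_inner_smul_right,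
    real_inner_comm x β]
  field_simp
  ring

lemma kk_sr {α β : V} (hβ : β ∈ S.R0) (hα : α ∈ S.R0) : S.kk (sr β α) = S.kk α :=
  S.kk_congr (S.sr_mem hβ hα) hα (S.inner_sr_sr hβ α)

lemma t_sr {α β : V} (hβ : β ∈ S.R0) (hα : α ∈ S.R0) : S.t (sr β α) = S.t α :=
  S.t_invariant β hβ α hα

lemma sr_self {α : V} (hα : α ∈ S.R0) : sr α α = -α := by
  rw [sr, S.inner_self_coroot hα, two_smul]
  abel

lemma neg_mem {α : V} (hα : α ∈ S.R0) : -α ∈ S.R0 := by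
  rw [← S.sr_self hα]; exact S.sr_mem hα hα

lemma kk_neg {α : V} (hα : α ∈ S.R0) : S.kk (-α) = S.kk α := by
  rw [← S.sr_self hα]; exact S.kk_sr hα hα

lemma t_neg {α : V} (hα : α ∈ S.R0) : S.t (-α) = S.t α := by
  rw [← S.sr_self hα]; exact S.t_sr hα hα

lemma sum_sr {β : V} (hβ : β ∈ S.R0) (f : V → ℝ) :
    ∑ α ∈ S.R0, f (sr β α) = ∑ α ∈ S.R0, f α :=
  Finset.sum_bij' (fun α _ => sr β α) (fun α _ => sr β α) (fun α h => S.sr_mem hβ h)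
    (fun α h => S.sr_mem hβ h) (fun α _ => S.sr_sr hβ α) (fun α _ => S.sr_sr hβ α)
    (fun α _ => rfl)

lemma sum_even (f : V → ℝ) (hf : ∀ α ∈ S.R0, f (-α) = f α) :
    ∑ α ∈ S.R0, f α = 2 * ∑ α ∈ S.Rpos, f α := by
  rw [← Finset.sum_sdiff S.pos_subset]
  have : ∑ α ∈ S.R0 \ S.Rpos, f α = ∑ α ∈ S.Rpos, f α := by
    refine Finset.sum_bij' (fun α _ => -α) (fun α _ => -α) ?_ ?_ ?_ ?_ ?_
    · intro α h
      rw [Finset.mem_sdiff] at h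
      by_contra hc
      exact h.2 ((S.pos_partition α h.1).mpr hc)
    · intro α h
      have h0 := S.pos_subset h
      rw [Finset.mem_sdiff]
      exact ⟨S.neg_mem h0, (S.pos_partition α h0).mp h⟩
    · intro α _; simp
    · intro α _; simp
    · intro α h
      rw [Finset.mem_sdiff] at h
      exact (hf α h.1).symm
  rw [this]; ring

/-- Key symmetrisation identity. -/
lemma sum_symm (ξ : V) {β : V} (hβ : β ∈ S.R0) :
    ∑ α ∈ S.Rpos, S.kk α * vE (S.t α) ⟪ξ, α⟫ * ⟪α, β⟫ =
      ∑ α ∈ S.Rpos, S.kk α * (⟪β, β⟫ / 4) * (⟪α, coroot β⟫ *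
        (vE (S.t α) ⟪ξ, α⟫ - vE (S.t α) (⟪ξ, α⟫ - ⟪α, coroot β⟫ * ⟪ξ, β⟫))) := by
  have hpos := S.inner_self_pos hβ
  have e1 := S.sum_even (fun α => S.kk α * vE (S.t α) ⟪ξ, α⟫ * ⟪α, β⟫) (by
    intro α hα
    simp only [S.kk_neg hα, S.t_neg hα, inner_neg_right, inner_neg_left, vE_neg]
    ring)
  have e2 := S.sum_even (fun α => S.kk α * (⟪β, β⟫ / 4) * (⟪α, coroot β⟫ *
        (vE (S.t α) ⟪ξ, α⟫ - vE (S.t α) (⟪ξ, α⟫ - ⟪α, coroot β⟫ * ⟪ξ, β⟫)))) (by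
    intro α hα
    have : ⟪ξ, -α⟫ - ⟪-α, coroot β⟫ * ⟪ξ, β⟫ = -(⟪ξ, α⟫ - ⟪α, coroot β⟫ * ⟪ξ, β⟫) := by
      rw [inner_neg_right, inner_neg_left]; ring
    simp only [this]
    simp only [S.kk_neg hα, S.t_neg hα, inner_neg_right, inner_neg_left, vE_neg]
    ring)
  have e3 := S.sum_sr hβ (fun α => S.kk α * vE (S.t α) ⟪ξ, α⟫ * ⟪α, β⟫)
  have e4 : ∑ α ∈ S.R0, S.kk α * (⟪β, β⟫ / 4) * (⟪α, coroot β⟫ *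
        (vE (S.t α) ⟪ξ, α⟫ - vE (S.t α) (⟪ξ, α⟫ - ⟪α, coroot β⟫ * ⟪ξ, β⟫))) =
      ∑ α ∈ S.R0, (2⁻¹ * (S.kk α * vE (S.t α) ⟪ξ, α⟫ * ⟪α, β⟫) +
        2⁻¹ * (S.kk (sr β α) * vE (S.t (sr β α)) ⟪ξ, sr β α⟫ * ⟪sr β α, β⟫)) := by
    refine Finset.sum_congr rfl fun α hα => ?_
    rw [S.kk_sr hβ hα, S.t_sr hβ hα, S.inner_sr_left hβ]
    have h1 : ⟪ξ, sr β α⟫ = ⟪ξ, α⟫ - ⟪α, coroot β⟫ * ⟪ξ, β⟫ := by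
      rw [sr, inner_sub_right, real_inner_smul_right]
    have h2 : ⟪α, β⟫ = ⟪β, β⟫ / 2 * ⟪α, coroot β⟫ := by
      rw [inner_coroot]; field_simp
    rw [h1, h2]
    ring
  rw [Finset.sum_add_distrib, ← Finset.mul_sum, ← Finset.mul_sum] at e4
  linarith

/-! ### Positivity of `ρ̂` on simple roots -/

lemma simple_linearIndependent : LinearIndependent ℝ S.simple := by
  apply linearIndependent_of_top_le_span_of_card_eq_finrank
  · rw [← S.span_top, Submodule.span_le]
    have hp : ∀ α ∈ S.Rpos, α ∈ Submodule.span ℝ (Set.range S.simple) := by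
      intro α hα
      obtain ⟨f, hf⟩ := S.pos_decomp α hα
      rw [hf]
      exact Submodule.sum_mem _ fun j _ =>
        Submodule.smul_mem _ _ (Submodule.subset_span ⟨j, rfl⟩)
    intro α hα
    by_cases h : α ∈ S.Rpos
    · exact hp α h
    · have : -α ∈ S.Rpos := by
        by_contra hc
        exact h ((S.pos_partition α hα).mpr hc)
      have := hp _ this
      exact (Submodule.neg_mem_iff _).mp this
  · rw [S.hdim, Fintype.card_fin]

lemma sr_simple_mem (j : Fin S.n) {α : V} (hα : α ∈ S.Rpos) (hne : α ≠ S.simple j) :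
    sr (S.simple j) α ∈ S.Rpos := by
  have hα0 := S.pos_subset hα
  have hj0 := S.pos_subset (S.simple_mem j)
  rw [S.pos_partition _ (S.sr_mem hj0 hα0)]
  intro hneg
  obtain ⟨f, hf⟩ := S.pos_decomp α hα
  obtain ⟨g, hg⟩ := S.pos_decomp _ hneg
  have hsum : ∑ i, ((f i : ℝ) + g i - if i = j then ⟪α, coroot (S.simple j)⟫ else 0) •
      S.simple i = 0 := by
    simp only [sub_smul, add_smul, Finset.sum_sub_distrib, Finset.sum_add_distrib]
    rw [← hf, ← hg]
    simp [sr]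
  have hli := Fintype.linearIndependent_iff.mp S.simple_linearIndependent _ hsum
  have hz : ∀ i, i ≠ j → (f i : ℝ) = 0 := by
    intro i hi
    have := hli i
    rw [if_neg hi] at this
    have h1 : (0 : ℝ) ≤ f i := Nat.cast_nonneg _
    have h2 : (0 : ℝ) ≤ g i := Nat.cast_nonneg _
    linarith
  have hαj : α = (f j : ℝ) • S.simple j := by
    rw [hf, Finset.sum_eq_single j]
    · intro i _ hi
      rw [hz i hi, zero_smul]
    · simp
  rcases S.reduced _ hj0 (f j) (hαj ▸ hα0) with h | h
  · rw [h, one_smul] at hαj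
    exact hne hαj
  · have h1 : (0 : ℝ) ≤ f j := Nat.cast_nonneg _
    linarith

lemma inner_rhoHat (β : V) : ⟪S.rhoHat, β⟫ = 2⁻¹ * ∑ α ∈ S.Rpos, S.kk α * ⟪α, β⟫ := by
  rw [rhoHat, real_inner_smul_left, sum_inner]
  congr 1
  refine Finset.sum_congr rfl fun α hα => ?_
  rw [S.hat_eq (S.pos_subset hα), real_inner_smul_left]

lemma rhoHat_simple_pos (j : Fin S.n) : 0 < ⟪S.rhoHat, S.simple j⟫ := by
  have hj := S.simple_mem j
  have hj0 := S.pos_subset hj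
  rw [inner_rhoHat, ← Finset.add_sum_erase _ _ hj]
  have hz : ∑ α ∈ S.Rpos.erase (S.simple j), S.kk α * ⟪α, S.simple j⟫ =
      -∑ α ∈ S.Rpos.erase (S.simple j), S.kk α * ⟪α, S.simple j⟫ := by
    have hmem : ∀ α ∈ S.Rpos.erase (S.simple j),
        sr (S.simple j) α ∈ S.Rpos.erase (S.simple j) := by
      intro α hα
      rw [Finset.mem_erase] at hα ⊢
      refine ⟨?_, S.sr_simple_mem j hα.2 hα.1⟩
      intro hc
      have h1 := S.sr_sr hj0 α
      rw [hc, S.sr_self hj0] at h1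
      have := (S.pos_partition _ hj0).mp hj
      exact this (h1 ▸ hα.2)
    rw [← Finset.sum_neg_distrib]
    refine Finset.sum_bij' (fun α _ => sr (S.simple j) α) (fun α _ => sr (S.simple j) α)
      hmem hmem (fun α _ => S.sr_sr hj0 α) (fun α _ => S.sr_sr hj0 α) ?_
    intro α hα
    have hα0 := S.pos_subset (Finset.mem_of_mem_erase hα)
    rw [S.kk_sr hj0 hα0, S.inner_sr_left hj0]
    ring
  have h1 := S.kk_pos hj0
  have h2 := S.inner_self_pos hj0
  have : 0 < S.kk (S.simple j) * ⟪S.simple j, S.simple j⟫ := by positivity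
  linarith

/-! ### The gradient of the Morse function -/

/-- The gradient of `MorseOf`. -/
def grad (s : V → ℝ) (μ ξ : V) : V :=
  (S.c : ℝ) • ξ + ∑ α ∈ S.Rpos, (S.kk α * vE (s α) ⟪ξ, α⟫) • α -
    (2 * Real.pi) • (S.rhoHat + μ)

lemma inner_grad (s : V → ℝ) (μ ξ y : V) : ⟪S.grad s μ ξ, y⟫ = (S.c : ℝ) * ⟪ξ, y⟫ +
    ∑ α ∈ S.Rpos, S.kk α * vE (s α) ⟪ξ, α⟫ * ⟪α, y⟫ -
    2 * Real.pi * ⟪S.rhoHat + μ, y⟫ := by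
  rw [grad, inner_sub_left, inner_add_left, real_inner_smul_left, real_inner_smul_left, sum_inner]
  simp only [real_inner_smul_left]

lemma c_pos : (0 : ℝ) < S.c := by
  have := S.c_gt
  exact_mod_cast (by omega : 0 < S.c)

lemma MorseOf_eq (s : V → ℝ) (hs : ∀ α ∈ S.R0, |s α| < 1) (μ ξ : V) :
    S.MorseOf s μ ξ = ((S.c : ℝ) / 2) * ⟪ξ, ξ⟫ - 2 * Real.pi * ⟪S.rhoHat + μ, ξ⟫ +
    ∑ α ∈ S.Rpos, S.kk α * ∫ x in (0:ℝ)..(⟪ξ, α⟫), vE (s α) x := by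
  rw [MorseOf]
  congr 1
  refine Finset.sum_congr rfl fun α hα => ?_
  rw [vintOf_eq s α (hs α (S.pos_subset hα))]
  rfl

lemma MorseOf_ge (s : V → ℝ) (hs : ∀ α ∈ S.R0, |s α| < 1) (μ a x : V) :
    S.MorseOf s μ a + ⟪S.grad s μ a, x - a⟫ + ((S.c : ℝ) / 2) * ⟪x - a, x - a⟫ ≤
      S.MorseOf s μ x := by
  rw [S.MorseOf_eq s hs, S.MorseOf_eq s hs, inner_grad]
  have h : ∑ α ∈ S.Rpos, S.kk α * vE (s α) ⟪a, α⟫ * ⟪α, x - a⟫ ≤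
      ∑ α ∈ S.Rpos, (S.kk α * (∫ x in (0:ℝ)..(⟪x, α⟫), vE (s α) x) -
        S.kk α * ∫ x in (0:ℝ)..(⟪a, α⟫), vE (s α) x) := by
    refine Finset.sum_le_sum fun α hα => ?_
    have h0 := S.pos_subset hα
    have h1 := int_vE_ge (hs α h0) ⟪a, α⟫ ⟪x, α⟫
    have h2 : ⟪α, x - a⟫ = ⟪x, α⟫ - ⟪a, α⟫ := by
      rw [inner_sub_right, real_inner_comm, real_inner_comm a α]
    rw [h2, mul_assoc, ← mul_sub]
    exact mul_le_mul_of_nonneg_left h1 (S.kk_pos h0).le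
  rw [Finset.sum_sub_distrib] at h
  have e1 : ⟪x - a, x - a⟫ = ⟪x, x⟫ - 2 * ⟪a, x⟫ + ⟪a, a⟫ := by
    rw [inner_sub_left, inner_sub_right, inner_sub_right, real_inner_comm a x]
    ring
  rw [e1]
  simp only [inner_sub_right] at h ⊢
  linarith

lemma morse_lt_of_grad (s : V → ℝ) (hs : ∀ α ∈ S.R0, |s α| < 1) {μ a : V}
    (ha : S.grad s μ a = 0) (x : V) (hx : x ≠ a) : S.MorseOf s μ a < S.MorseOf s μ x := by
  have h := S.MorseOf_ge s hs μ a x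
  rw [ha, inner_zero_left] at h
  have h1 : 0 < ⟪x - a, x - a⟫ := real_inner_self_pos.mpr (sub_ne_zero.mpr hx)
  have h2 := S.c_pos
  have : 0 < (S.c : ℝ) / 2 * ⟪x - a, x - a⟫ := by positivity
  linarith

lemma continuous_grad (s : V → ℝ) (hs : ∀ α ∈ S.R0, |s α| < 1) (μ : V) :
    Continuous (S.grad s μ) := by
  unfold grad
  refine ((continuous_const.smul continuous_id).add
    (continuous_finsetSum _ fun α hα => ?_)).sub continuous_const
  have := continuous_vE (hs α (S.pos_subset hα))
  fun_prop

lemma grad_of_min (s : V → ℝ) (hs : ∀ α ∈ S.R0, |s α| < 1) {μ a : V}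
    (ha : ∀ x, S.MorseOf s μ a ≤ S.MorseOf s μ x) : S.grad s μ a = 0 := by
  set g := S.grad s μ a with hg
  have key : ∀ r : ℝ, 0 < r → ⟪S.grad s μ (a - r • g), g⟫ ≤ 0 := by
    intro r hr
    have h1 := S.MorseOf_ge s hs μ (a - r • g) a
    have h2 := ha (a - r • g)
    have e : a - (a - r • g) = r • g := by abel
    rw [e, real_inner_smul_right] at h1
    have h3 : 0 ≤ ⟪r • g, r • g⟫ := real_inner_self_nonneg
    have h4 := S.c_pos
    have h5 : 0 ≤ (S.c : ℝ) / 2 * ⟪r • g, r • g⟫ := by positivity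
    by_contra hc
    push Not at hc
    have := mul_pos hr hc
    linarith
  have hc : Continuous fun r : ℝ => ⟪S.grad s μ (a - r • g), g⟫ :=
    ((S.continuous_grad s hs μ).comp (by fun_prop)).inner continuous_const
  have ht : Tendsto (fun r : ℝ => ⟪S.grad s μ (a - r • g), g⟫) (nhdsWithin 0 (Set.Ioi 0))
      (nhds ⟪S.grad s μ (a - (0 : ℝ) • g), g⟫) :=
    (hc.tendsto 0).mono_left nhdsWithin_le_nhds
  have hle := le_of_tendsto ht (eventually_nhdsWithin_of_forall fun r hr => key r hr)
  rw [zero_smul, sub_zero, ← hg] at hle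
  exact inner_self_eq_zero.mp (le_antisymm hle real_inner_self_nonneg)

lemma continuous_MorseOf (s : V → ℝ) (hs : ∀ α ∈ S.R0, |s α| < 1) (μ : V) :
    Continuous (S.MorseOf s μ) := by
  have : S.MorseOf s μ = fun ξ => ((S.c : ℝ) / 2) * ⟪ξ, ξ⟫ - 2 * Real.pi * ⟪S.rhoHat + μ, ξ⟫ +
    ∑ α ∈ S.Rpos, S.kk α * ∫ x in (0:ℝ)..(⟪ξ, α⟫), vE (s α) x :=
    funext fun ξ => S.MorseOf_eq s hs μ ξ
  rw [this]
  refine Continuous.add (by fun_prop) (continuous_finsetSum _ fun α hα => ?_)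
  have h := continuous_vE (hs α (S.pos_subset hα))
  have h2 : Continuous fun b : ℝ => ∫ x in (0:ℝ)..b, vE (s α) x :=
    intervalIntegral.continuous_primitive (fun a b => h.intervalIntegrable a b) 0
  exact continuous_const.mul (h2.comp (by fun_prop))

lemma exists_grad_zero (s : V → ℝ) (hs : ∀ α ∈ S.R0, |s α| < 1) (μ : V) :
    ∃ a, S.grad s μ a = 0 := by
  have hcoer : Tendsto (S.MorseOf s μ) (cocompact V) atTop := by
    have hc := S.c_pos
    set C := ‖S.grad s μ 0‖
    have h1 : Tendsto (fun r : ℝ => S.MorseOf s μ 0 + r * ((S.c : ℝ) / 2 * r + -C)) atTop atTop := by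
      refine tendsto_atTop_add_const_left _ _ (tendsto_id.atTop_mul_atTop₀ ?_)
      exact tendsto_atTop_add_const_right _ _ (tendsto_id.const_mul_atTop (by positivity))
    refine tendsto_atTop_mono ?_ (h1.comp (tendsto_norm_cocompact_atTop (E := V)))
    intro x
    have h := S.MorseOf_ge s hs μ 0 x
    rw [sub_zero, real_inner_self_eq_norm_sq] at h
    have h2 := neg_le_of_abs_le (abs_real_inner_le_norm (S.grad s μ 0) x)
    simp only [Function.comp]
    nlinarith
  obtain ⟨a, ha⟩ := (S.continuous_MorseOf s hs μ).exists_forall_le hcoer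
  exact ⟨a, S.grad_of_min s hs ha⟩

/-! ### The alcove -/

lemma grad_zero_eq {μ ξ : V} (h : S.grad S.t μ ξ = 0) (β : V) :
    (S.c : ℝ) * ⟪ξ, β⟫ + ∑ α ∈ S.Rpos, S.kk α * vE (S.t α) ⟪ξ, α⟫ * ⟪α, β⟫ =
      2 * Real.pi * (⟪S.rhoHat, β⟫ + ⟪μ, β⟫) := by
  have := S.inner_grad S.t μ ξ β
  rw [h, inner_zero_left, inner_add_left] at this
  linarith

lemma alcove_simple {μ ξ : V} (h : S.grad S.t μ ξ = 0) (hμ : μ ∈ S.Phatc) (j : Fin S.n) :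
    0 < ⟪ξ, S.simple j⟫ := by
  by_contra hc
  push Not at hc
  have hj0 := S.pos_subset (S.simple_mem j)
  have h1 := S.grad_zero_eq h (S.simple j)
  have h2 := S.rhoHat_simple_pos j
  have h3 := (hμ.2 _ (S.simple_mem j)).1
  have h4 : ∑ α ∈ S.Rpos, S.kk α * vE (S.t α) ⟪ξ, α⟫ * ⟪α, S.simple j⟫ ≤ 0 := by
    rw [S.sum_symm ξ hj0]
    refine Finset.sum_nonpos fun α hα => ?_
    have hα0 := S.pos_subset hα
    refine mul_nonpos_of_nonneg_of_nonpos ?_ (vE_step_le (S.t_bound α hα0) _ hc _)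
    have := S.kk_pos hα0
    have := S.inner_self_pos hj0
    positivity
  have h5 := S.c_pos
  have h6 : (S.c : ℝ) * ⟪ξ, S.simple j⟫ ≤ 0 := mul_nonpos_of_nonneg_of_nonpos h5.le hc
  have h7 : 0 < 2 * Real.pi * (⟪S.rhoHat, S.simple j⟫ + ⟪μ, S.simple j⟫) := by
    have := Real.pi_pos
    positivity
  linarith

lemma alcove_pos {μ ξ : V} (h : S.grad S.t μ ξ = 0) (hμ : μ ∈ S.Phatc) {β : V}
    (hβ : β ∈ S.Rpos) : 0 < ⟪ξ, β⟫ := by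
  obtain ⟨f, hf⟩ := S.pos_decomp β hβ
  have hnn : 0 ≤ ⟪ξ, β⟫ := by
    rw [hf, inner_sum]
    refine Finset.sum_nonneg fun j _ => ?_
    rw [real_inner_smul_right]
    exact mul_nonneg (Nat.cast_nonneg _) (S.alcove_simple h hμ j).le
  refine lt_of_le_of_ne hnn fun h0 => ?_
  have hz : ∑ j, (f j : ℝ) * ⟪ξ, S.simple j⟫ = 0 := by
    rw [h0, hf, inner_sum]
    simp only [real_inner_smul_right]
  rw [Finset.sum_eq_zero_iff_of_nonneg (fun j _ =>
    mul_nonneg (Nat.cast_nonneg _) (S.alcove_simple h hμ j).le)] at hz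
  apply S.ne_zero_of_mem (S.pos_subset hβ)
  rw [hf]
  refine Finset.sum_eq_zero fun j hj => ?_
  rcases mul_eq_zero.mp (hz j hj) with h1 | h1
  · rw [h1, zero_smul]
  · exact absurd h1 (S.alcove_simple h hμ j).ne'

lemma alcove_lt {μ ξ : V} (h : S.grad S.t μ ξ = 0) (hμ : μ ∈ S.Phatc) {β : V}
    (hβ : β ∈ S.Rpos) : ⟪ξ, β⟫ < 2 * Real.pi := by
  by_contra hc
  push Not at hc
  have hpi := Real.pi_pos
  have hβ0 := S.pos_subset hβ
  have hββ := S.inner_self_pos hβ0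
  have h1 := S.grad_zero_eq h β
  have h3 := (hμ.2 _ hβ).2
  have h5 := S.c_pos
  have h4 : ∑ α ∈ S.Rpos, Real.pi * (S.kk α * ⟪α, β⟫) <
      ∑ α ∈ S.Rpos, S.kk α * vE (S.t α) ⟪ξ, α⟫ * ⟪α, β⟫ := by
    rw [S.sum_symm ξ hβ0]
    have key : ∀ α ∈ S.Rpos, Real.pi * (S.kk α * ⟪α, β⟫) + S.kk α * (⟪β, β⟫ / 2) * Real.pi *
        (⟪α, coroot β⟫ ^ 2 - ⟪α, coroot β⟫) ≤ S.kk α * (⟪β, β⟫ / 4) * (⟪α, coroot β⟫ *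
        (vE (S.t α) ⟪ξ, α⟫ - vE (S.t α) (⟪ξ, α⟫ - ⟪α, coroot β⟫ * ⟪ξ, β⟫))) := by
      intro α hα
      have hα0 := S.pos_subset hα
      have hk := S.kk_pos hα0
      obtain ⟨k, hk2⟩ := S.cryst β hβ0 α hα0
      have e2 : ⟪α, β⟫ = ⟪β, β⟫ / 2 * ⟪α, coroot β⟫ := by
        rw [inner_coroot]; field_simp
      rw [e2, hk2]
      have := mul_le_mul_of_nonneg_left (vE_step_ge (S.t_bound α hα0) k hc ⟪ξ, α⟫)
        (by positivity : 0 ≤ S.kk α * (⟪β, β⟫ / 4))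
      linarith
    have nn : ∀ α ∈ S.Rpos, 0 ≤ ⟪α, coroot β⟫ ^ 2 - ⟪α, coroot β⟫ := by
      intro α hα
      obtain ⟨k, hk2⟩ := S.cryst β hβ0 α (S.pos_subset hα)
      rw [hk2]
      have : k ≤ k ^ 2 := Int.le_self_sq k
      have : (k : ℝ) ≤ (k : ℝ) ^ 2 := by exact_mod_cast this
      linarith
    refine Finset.sum_lt_sum (fun α hα => ?_) ⟨β, hβ, ?_⟩
    · refine le_trans ?_ (key α hα)
      have := nn α hα
      have := S.kk_pos (S.pos_subset hα)
      have : 0 ≤ S.kk α * (⟪β, β⟫ / 2) * Real.pi * (⟪α, coroot β⟫ ^ 2 - ⟪α, coroot β⟫) := by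
        positivity
      linarith
    · refine lt_of_lt_of_le ?_ (key β hβ)
      rw [S.inner_self_coroot hβ0]
      have := S.kk_pos hβ0
      have : 0 < S.kk β * (⟪β, β⟫ / 2) * Real.pi * ((2:ℝ) ^ 2 - 2) := by
        have h2 : (0:ℝ) < 2 ^ 2 - 2 := by norm_num
        exact mul_pos (by positivity) h2
      linarith
  rw [← Finset.mul_sum] at h4
  rw [S.inner_rhoHat] at h1
  have h6 : (S.c : ℝ) * (2 * Real.pi) ≤ S.c * ⟪ξ, β⟫ := mul_le_mul_of_nonneg_left hc h5.le
  have h7 : 2 * Real.pi * ⟪μ, β⟫ ≤ 2 * Real.pi * S.c := mul_le_mul_of_nonneg_left h3 (by positivity)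
  linarith

/-! ### Analytic dependence -/

lemma extParam_mem (s : ↥S.R0 → ℝ) {α : V} (h : α ∈ S.R0) : S.extParam s α = s ⟨α, h⟩ := by
  rw [extParam, dif_pos h]

lemma extParam_bound (s : ↥S.R0 → ℝ) (hs : ∀ a, |s a| < 1) : ∀ α ∈ S.R0, |S.extParam s α| < 1 := by
  intro α h
  rw [S.extParam_mem s h]
  exact hs _

open scoped ContDiff in
lemma contDiffAt_grad (μ : V) (s : ↥S.R0 → ℝ) (hs : ∀ a, |s a| < 1) (ξ : V) :
    ContDiffAt ℝ ω (fun p : (↥S.R0 → ℝ) × V => S.grad (S.extParam p.1) μ p.2) (s, ξ) := by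
  unfold grad
  refine ContDiffAt.sub (ContDiffAt.add (contDiffAt_snd.const_smul _)
    (ContDiffAt.sum fun α hα => ?_)) contDiffAt_const
  have hα0 := S.pos_subset hα
  refine ContDiffAt.smul (contDiffAt_const.mul ?_) contDiffAt_const
  simp only [S.extParam_mem _ hα0, vE]
  have hp : ContDiffAt ℝ ω (fun p : (↥S.R0 → ℝ) × V => p.1 ⟨α, hα0⟩) (s, ξ) := by fun_prop
  have hi : ContDiffAt ℝ ω (fun p : (↥S.R0 → ℝ) × V => ⟪p.2, α⟫) (s, ξ) :=
    contDiffAt_snd.inner ℝ contDiffAt_const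
  have hn : ContDiffAt ℝ ω (fun p : (↥S.R0 → ℝ) × V =>
      p.1 ⟨α, hα0⟩ * Real.sin ⟪p.2, α⟫) (s, ξ) := hp.mul hi.sin
  have hd : ContDiffAt ℝ ω (fun p : (↥S.R0 → ℝ) × V =>
      1 - p.1 ⟨α, hα0⟩ * Real.cos ⟪p.2, α⟫) (s, ξ) := contDiffAt_const.sub (hp.mul hi.cos)
  have hq : AnalyticAt ℝ (fun p : (↥S.R0 → ℝ) × V => p.1 ⟨α, hα0⟩ * Real.sin ⟪p.2, α⟫ /
      (1 - p.1 ⟨α, hα0⟩ * Real.cos ⟪p.2, α⟫)) (s, ξ) :=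
    hn.analyticAt.fun_div hd.analyticAt (den_pos (hs _) _).ne'
  exact hi.add (contDiffAt_const.mul (Real.contDiff_arctan.contDiffAt.comp _ hq.contDiffAt))

lemma grad_mono (s : V → ℝ) (hs : ∀ α ∈ S.R0, |s α| < 1) (μ x y : V) :
    (S.c : ℝ) * ⟪x - y, x - y⟫ ≤ ⟪S.grad s μ x - S.grad s μ y, x - y⟫ := by
  have h1 := S.MorseOf_ge s hs μ x y
  have h2 := S.MorseOf_ge s hs μ y x
  have e : y - x = -(x - y) := by abel
  rw [e, inner_neg_right, inner_neg_neg] at h1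
  rw [inner_sub_left (S.grad s μ x)]
  linarith

open scoped ContDiff in
lemma analyticAt_of_grad (Ξ : (↥S.R0 → ℝ) → V) (μ : V)
    (hΞ : ∀ s : ↥S.R0 → ℝ, (∀ a, |s a| < 1) → S.grad (S.extParam s) μ (Ξ s) = 0)
    (s : ↥S.R0 → ℝ) (hs : ∀ a, |s a| < 1) : AnalyticAt ℝ Ξ s := by
  have cdf := S.contDiffAt_grad μ s hs (Ξ s)
  set G := fun p : (↥S.R0 → ℝ) × V => S.grad (S.extParam p.1) μ p.2 with hG
  have hω : (ω : WithTop ℕ∞) ≠ 0 := by simp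
  set L := fderiv ℝ G (s, Ξ s) ∘L ContinuousLinearMap.inr ℝ (↥S.R0 → ℝ) V with hL
  have hbd := S.extParam_bound s hs
  have hpos : ∀ w : V, (S.c : ℝ) * ⟪w, w⟫ ≤ ⟪L w, w⟫ := by
    intro w
    have hd : HasFDerivAt G (fderiv ℝ G (s, Ξ s)) (s, Ξ s) :=
      (cdf.differentiableAt hω).hasFDerivAt
    have hline : HasDerivAt (fun r : ℝ => ((s, Ξ s + r • w) : (↥S.R0 → ℝ) × V)) (0, w) 0 := by
      refine (hasDerivAt_const (0:ℝ) s).prodMk ?_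
      have := ((hasDerivAt_id (0:ℝ)).smul_const w).const_add (Ξ s)
      simpa using this
    have hd' : HasFDerivAt G (fderiv ℝ G (s, Ξ s)) ((fun r : ℝ =>
      ((s, Ξ s + r • w) : (↥S.R0 → ℝ) × V)) 0) := by simpa using hd
    have h1 : HasDerivAt (fun r : ℝ => G (s, Ξ s + r • w)) (L w) 0 := by
      have hLw : L w = fderiv ℝ G (s, Ξ s) (0, w) := by simp [hL]
      rw [hLw]
      exact hd'.comp_hasDerivAt (0:ℝ) hline
    have h2 : HasDerivAt (fun r : ℝ => ⟪G (s, Ξ s + r • w), w⟫ - r * (S.c * ⟪w, w⟫))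
        (⟪L w, w⟫ - S.c * ⟪w, w⟫) 0 := by
      have a1 := h1.inner ℝ (hasDerivAt_const (0:ℝ) w)
      have a2 := (hasDerivAt_id (0:ℝ)).mul_const (S.c * ⟪w, w⟫)
      have := a1.sub a2
      refine this.congr_deriv ?_
      simp
    have hm : Monotone (fun r : ℝ => ⟪G (s, Ξ s + r • w), w⟫ - r * (S.c * ⟪w, w⟫)) := by
      intro a b hab
      rcases hab.eq_or_lt with rfl | hab
      · exact le_rfl
      have h := S.grad_mono (S.extParam s) hbd μ (Ξ s + b • w) (Ξ s + a • w)
      have e : Ξ s + b • w - (Ξ s + a • w) = (b - a) • w := by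
        rw [sub_smul]; abel
      rw [e, real_inner_smul_right, real_inner_smul_right, real_inner_smul_left,
        inner_sub_left] at h
      have hba : 0 < b - a := sub_pos.mpr hab
      have h' : (b - a) * ((b - a) * (S.c * ⟪w, w⟫)) ≤ (b - a) *
          (⟪G (s, Ξ s + b • w), w⟫ - ⟪G (s, Ξ s + a • w), w⟫) := by
        simp only [hG]
        linarith
      have := le_of_mul_le_mul_left h' hba
      simp only
      linarith
    have := hm.deriv_nonneg (x := 0)
    rw [h2.deriv] at this
    linarith
  have hinj : Function.Injective L := by
    rw [injective_iff_map_eq_zero]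
    intro w hw
    have h1 := hpos w
    rw [hw, inner_zero_left] at h1
    have hc := S.c_pos
    by_contra hne
    have h2 : 0 < ⟪w, w⟫ := real_inner_self_pos.mpr hne
    have := mul_pos hc h2
    linarith
  have hinv : L.IsInvertible := by
    refine ⟨(LinearEquiv.ofInjectiveEndo (L : V →ₗ[ℝ] V) hinj).toContinuousLinearEquiv, ?_⟩
    ext w
    rfl
  have hcd := cdf.contDiffAt_implicitFunction hω hinv
  have hev := cdf.eventually_apply_implicitFunction hω hinv
  have hopen : ∀ᶠ u : ↥S.R0 → ℝ in nhds s, ∀ a, |u a| < 1 := by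
    rw [eventually_all]
    intro a
    have : Continuous fun u : ↥S.R0 → ℝ => |u a| := by fun_prop
    exact this.continuousAt.eventually_lt continuousAt_const (hs a)
  refine hcd.analyticAt.congr ?_
  filter_upwards [hev, hopen] with u hu hu1
  have h0 : G (s, Ξ s) = 0 := hΞ s hs
  rw [h0] at hu
  have h1 := S.morse_lt_of_grad (S.extParam u) (S.extParam_bound u hu1) hu (Ξ u)
  have h2 := S.morse_lt_of_grad (S.extParam u) (S.extParam_bound u hu1) (hΞ u hu1)
    (cdf.implicitFunction hω hinv u)
  by_contra hne
  exact lt_asymm (h1 (Ne.symm hne)) (h2 hne)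

end Setup

/-- the critical points `ξ_μ`, `μ ∈ P̂_c`, are pairwise distinct, belong to
the open alcove `A = {ξ | 0 < ⟨ξ,α⟩ < 2π ∀ α ∈ R₀⁺}`, and depend real-analytically on
the parameters `t_α ∈ (-1,1)`. -/
theorem statement2 (S : Setup V) (xi : V → V) (hxi : S.IsMinimizer xi) :
    (∀ μ ∈ S.Phatc, ∀ ν ∈ S.Phatc, μ ≠ ν → xi μ ≠ xi ν) ∧
    (∀ μ ∈ S.Phatc, ∀ α ∈ S.Rpos, 0 < ⟪xi μ, α⟫ ∧ ⟪xi μ, α⟫ < 2 * Real.pi) ∧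
    ∃ Ξ : (↥S.R0 → ℝ) → V → V,
      (∀ s : ↥S.R0 → ℝ, (∀ a, |s a| < 1) → ∀ μ ∈ S.Phat, ∀ x : V, x ≠ Ξ s μ →
          S.MorseOf (S.extParam s) μ (Ξ s μ) < S.MorseOf (S.extParam s) μ x) ∧
      (∀ μ ∈ S.Phatc, Ξ (fun a => S.t a.1) μ = xi μ) ∧
      (∀ μ ∈ S.Phatc, ∀ s : ↥S.R0 → ℝ, (∀ a, |s a| < 1) →
          AnalyticAt ℝ (fun u => Ξ u μ) s) := by
  have hb : ∀ α ∈ S.R0, |S.t α| < 1 := S.t_bound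
  have hgrad : ∀ μ ∈ S.Phat, S.grad S.t μ (xi μ) = 0 := by
    intro μ hμ
    refine S.grad_of_min S.t hb fun x => ?_
    by_cases hx : x = xi μ
    · rw [hx]
    · exact (hxi μ hμ x hx).le
  refine ⟨?_, ?_, ?_⟩
  · intro μ hμ ν hν hne heq
    have h1 := hgrad μ hμ.1
    have h2 := hgrad ν hν.1
    rw [heq, Setup.grad, sub_eq_zero] at h1
    rw [Setup.grad, sub_eq_zero] at h2
    rw [h1] at h2
    have hpi : (2 * Real.pi) ≠ 0 := by have := Real.pi_pos; positivity
    exact hne (add_left_cancel (smul_right_injective V hpi h2))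
  · intro μ hμ α hα
    exact ⟨S.alcove_pos (hgrad μ hμ.1) hμ hα, S.alcove_lt (hgrad μ hμ.1) hμ hα⟩
  · have hex : ∀ (s : ↥S.R0 → ℝ) (μ : V), ∃ a : V,
        (∀ b, |s b| < 1) → S.grad (S.extParam s) μ a = 0 := by
      intro s μ
      by_cases hs : ∀ b, |s b| < 1
      · obtain ⟨a, ha⟩ := S.exists_grad_zero _ (S.extParam_bound s hs) μ
        exact ⟨a, fun _ => ha⟩
      · exact ⟨0, fun h => absurd h hs⟩
    choose Ξ hΞ using hex
    refine ⟨Ξ, ?_, ?_, ?_⟩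
    · intro s hs μ _ x hx
      exact S.morse_lt_of_grad _ (S.extParam_bound s hs) (hΞ s μ hs) x hx
    · intro μ hμ
      have hs : ∀ a : ↥S.R0, |S.t a.1| < 1 := fun a => hb a.1 a.2
      have h1 := hΞ (fun a => S.t a.1) μ hs
      have h2 : S.grad S.t μ (Ξ (fun a => S.t a.1) μ) = 0 := by
        rw [← h1, Setup.grad, Setup.grad]
        congr 2
        refine Finset.sum_congr rfl fun α hα => ?_
        rw [S.extParam_mem _ (S.pos_subset hα)]
      by_contra hne
      exact lt_asymm (S.morse_lt_of_grad S.t hb h2 (xi μ) (Ne.symm hne))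
        (S.morse_lt_of_grad S.t hb (hgrad μ hμ.1) _ hne)
    · intro μ _ s hs
      exact S.analyticAt_of_grad (fun u => Ξ u μ) μ (fun u hu => hΞ u μ hu) s hs

end AffinePieri
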